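/- arXiv:2304.03478 — 3 statements merged into one kernel-verified Lean document; each statement's English description precedes it below -/
import Mathlib

section
/- Let n ≥ 1, let ν ∈ ℝ^{n+1} be a unit timelike vector (η(ν,ν) = −1) and let r > 0. Then the Lebesgue measure of the solid truncated light cone {p ∈ ℝ^{n+1} : η(p,p) < 0 and −r ≤ η(p,ν) ≤ 0} equals ω_n r^{n+1}/(n+1). -/
open MeasureTheory

/-- The Minkowski inner product on `ℝ^{n,1}`:
`η p q = -p₀q₀ + ∑_{i=1}^n pᵢqᵢ`. -/
noncomputable def minkowski {n : ℕ} (p q : Fin (n + 1) → ℝ) : ℝ :=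
  -(p 0 * q 0) + ∑ i : Fin (n + 1), if i = 0 then 0 else p i * q i

/-- `ω_n`, the Lebesgue volume of the unit ball in `ℝⁿ`. -/
noncomputable def unitBallVolume (n : ℕ) : ℝ :=
  (volume (Metric.ball (0 : EuclideanSpace ℝ (Fin n)) 1)).toReal

theorem minkowski_eq {n : ℕ} (p q : Fin (n + 1) → ℝ) :
    minkowski p q = -(p 0 * q 0) + ∑ i : Fin n, p i.succ * q i.succ := by
  simp [minkowski, Fin.sum_univ_succ, Fin.succ_ne_zero]

theorem minkowski_comm {n : ℕ} (p q : Fin (n + 1) → ℝ) : minkowski p q = minkowski q p := by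
  simp [minkowski_eq, mul_comm]

theorem minkowski_add_left {n : ℕ} (p q s : Fin (n + 1) → ℝ) :
    minkowski (p + q) s = minkowski p s + minkowski q s := by
  simp only [minkowski_eq, Pi.add_apply, add_mul, Finset.sum_add_distrib]
  ring

theorem minkowski_smul_left {n : ℕ} (c : ℝ) (p s : Fin (n + 1) → ℝ) :
    minkowski (c • p) s = c * minkowski p s := by
  simp only [minkowski_eq, Pi.smul_apply, smul_eq_mul, mul_assoc, ← Finset.mul_sum]
  ring

/-- The Minkowski inner product as a bilinear form. -/
noncomputable def minkowskiForm (n : ℕ) : LinearMap.BilinForm ℝ (Fin (n + 1) → ℝ) :=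
  LinearMap.mk₂ ℝ minkowski minkowski_add_left minkowski_smul_left
    (fun p q s => by
      rw [minkowski_comm, minkowski_add_left, minkowski_comm q, minkowski_comm s])
    (fun c p s => by
      rw [minkowski_comm, minkowski_smul_left, minkowski_comm s, smul_eq_mul])

/-- The Minkowski reflection in the hyperplane orthogonal to `w`. -/
noncomputable def minkowskiReflection {n : ℕ} (w : Fin (n + 1) → ℝ) :
    (Fin (n + 1) → ℝ) →ₗ[ℝ] (Fin (n + 1) → ℝ) :=
  LinearMap.id -
    ((minkowskiForm n).flip w).smulRight ((2 / minkowskiForm n w w) • w)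

theorem minkowskiReflection_apply {n : ℕ} (w p : Fin (n + 1) → ℝ) :
    minkowskiReflection w p =
      p - minkowskiForm n p w • (2 / minkowskiForm n w w) • w := rfl

theorem minkowskiForm_comm {n : ℕ} (p q : Fin (n + 1) → ℝ) :
    minkowskiForm n p q = minkowskiForm n q p := minkowski_comm p q

theorem minkowskiReflection_comp_self {n : ℕ} {w : Fin (n + 1) → ℝ}
    (hw : minkowskiForm n w w ≠ 0) :
    minkowskiReflection w ∘ₗ minkowskiReflection w = LinearMap.id := by
  refine LinearMap.ext fun p => ?_
  simp only [LinearMap.comp_apply, minkowskiReflection_apply, LinearMap.id_apply, map_sub,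
    map_smul]
  ext i
  simp only [Pi.sub_apply, Pi.smul_apply, smul_eq_mul]
  field_simp
  ring

theorem minkowskiForm_reflection_left {n : ℕ} (w p q : Fin (n + 1) → ℝ) :
    minkowskiForm n (minkowskiReflection w p) q =
      minkowskiForm n p (minkowskiReflection w q) := by
  simp only [minkowskiReflection_apply, map_sub, map_smul, LinearMap.sub_apply,
    LinearMap.smul_apply, smul_eq_mul]
  rw [minkowskiForm_comm w q]
  ring

theorem minkowskiForm_reflection_reflection {n : ℕ} {w : Fin (n + 1) → ℝ}
    (hw : minkowskiForm n w w ≠ 0) (p q : Fin (n + 1) → ℝ) :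
    minkowskiForm n (minkowskiReflection w p) (minkowskiReflection w q) =
      minkowskiForm n p q := by
  rw [minkowskiForm_reflection_left, ← LinearMap.comp_apply (minkowskiReflection w), minkowskiReflection_comp_self hw,
    LinearMap.id_apply]

/-- For two vectors of the same Minkowski square, the reflection along their difference
exchanges them. -/
theorem minkowskiReflection_sub_apply {n : ℕ} {u v : Fin (n + 1) → ℝ}
    (huv : minkowskiForm n u u = minkowskiForm n v v)
    (hw : minkowskiForm n (u - v) (u - v) ≠ 0) :
    minkowskiReflection (u - v) u = v := by
  have h : minkowskiForm n u (u - v) * (2 / minkowskiForm n (u - v) (u - v)) = 1 := by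
    field_simp
    simp only [map_sub, LinearMap.sub_apply]
    rw [minkowskiForm_comm v u]
    linarith
  rw [minkowskiReflection_apply, smul_smul, h, one_smul, sub_sub_cancel]

/-- A linear involution preserves Lebesgue measure. -/
theorem volume_preimage_of_comp_self_eq_id {ι : Type*} [Fintype ι]
    {f : (ι → ℝ) →ₗ[ℝ] (ι → ℝ)} (hf : f ∘ₗ f = LinearMap.id) (s : Set (ι → ℝ)) :
    volume (f ⁻¹' s) = volume s := by
  have hdet : LinearMap.det f * LinearMap.det f = 1 := by
    rw [← LinearMap.det_comp, hf, LinearMap.det_id]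
  have habs : |LinearMap.det f| = 1 := by
    rcases mul_self_eq_one_iff.1 hdet with h | h <;> simp [h]
  rw [Measure.addHaar_preimage_linearMap volume (fun h => by simp [h] at hdet), abs_inv, habs]
  simp

theorem volume_setOf_sum_mul_self_lt {n : ℕ} (hn : 1 ≤ n) {t : ℝ} (ht : 0 ≤ t) :
    volume {x : Fin n → ℝ | ∑ i, x i * x i < t * t} =
      ENNReal.ofReal (t ^ n * unitBallVolume n) := by
  have : Nonempty (Fin n) := ⟨⟨0, hn⟩⟩
  have hball : (WithLp.ofLp : EuclideanSpace ℝ (Fin n) → Fin n → ℝ) ⁻¹'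
      {x | ∑ i, x i * x i < t * t} = Metric.ball 0 t := by
    ext x
    simp only [Set.mem_preimage, Set.mem_ofPred_eq, mem_ball_zero_iff, EuclideanSpace.norm_eq,
      Real.norm_eq_abs, sq_abs]
    rw [Real.sqrt_lt (by positivity) ht]
    simp only [sq]
  have hmeas : MeasurableSet {x : Fin n → ℝ | ∑ i, x i * x i < t * t} :=
    measurableSet_lt (by fun_prop) (by fun_prop)
  rw [← (PiLp.volume_preserving_ofLp (Fin n)).measure_preimage
    hmeas.nullMeasurableSet, hball, Measure.addHaar_ball _ _ ht,
    ENNReal.ofReal_mul (by positivity), unitBallVolume,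
    ENNReal.ofReal_toReal measure_ball_lt_top.ne, finrank_euclideanSpace, Fintype.card_fin]

/-- The truncated light cone along the time axis. -/
theorem volume_vertical_truncated_cone {n : ℕ} (hn : 1 ≤ n) {r : ℝ} (hr : 0 < r) :
    volume {p : Fin (n + 1) → ℝ | minkowski p p < 0 ∧ 0 ≤ p 0 ∧ p 0 ≤ r} =
      ENNReal.ofReal (unitBallVolume n * r ^ (n + 1) / (n + 1)) := by
  set T : Set (ℝ × (Fin n → ℝ)) :=
    {q | ∑ i, q.2 i * q.2 i < q.1 * q.1 ∧ 0 ≤ q.1 ∧ q.1 ≤ r} with hT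
  have hTm : MeasurableSet T := by
    have h : MeasurableSet {q : ℝ × (Fin n → ℝ) | ∑ i, q.2 i * q.2 i < q.1 * q.1} :=
      measurableSet_lt (by fun_prop) (by fun_prop)
    exact h.inter (measurable_fst measurableSet_Icc)
  have hpre : {p : Fin (n + 1) → ℝ | minkowski p p < 0 ∧ 0 ≤ p 0 ∧ p 0 ≤ r} =
      MeasurableEquiv.piFinSuccAbove (fun _ => ℝ) 0 ⁻¹' T := by
    ext p
    simp [hT, minkowski_eq, MeasurableEquiv.piFinSuccAbove, Fin.tail]
  have hslice (t : ℝ) : volume (Prod.mk t ⁻¹' T) =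
      (Set.Icc 0 r).indicator (fun t => ENNReal.ofReal (t ^ n * unitBallVolume n)) t := by
    by_cases ht : t ∈ Set.Icc 0 r
    · rw [Set.indicator_of_mem ht, ← volume_setOf_sum_mul_self_lt hn ht.1]
      congr 1
      ext x
      simp [hT, ht.1, ht.2]
    · rw [Set.indicator_of_notMem ht]
      convert measure_empty (μ := (volume : Measure (Fin n → ℝ)))
      ext x
      simpa [hT] using fun _ h0 => not_le.1 fun h1 => ht ⟨h0, h1⟩
  have hint : IntegrableOn (fun t : ℝ => t ^ n * unitBallVolume n) (Set.Icc 0 r) :=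
    (by fun_prop : Continuous fun t : ℝ => t ^ n * unitBallVolume n).continuousOn.integrableOn_Icc
  rw [hpre, (volume_preserving_piFinSuccAbove (fun _ => ℝ) 0).measure_preimage
    hTm.nullMeasurableSet, Measure.volume_eq_prod, Measure.prod_apply hTm]
  simp_rw [hslice]
  rw [lintegral_indicator measurableSet_Icc, ← ofReal_integral_eq_lintegral_ofReal hint]
  · rw [integral_Icc_eq_integral_Ioc, ← intervalIntegral.integral_of_le hr.le,
      intervalIntegral.integral_mul_const, integral_pow]
    congr 1
    simp
    ring
  · filter_upwards [ae_restrict_mem measurableSet_Icc] with t ht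
    exact mul_nonneg (pow_nonneg ht.1 n) ENNReal.toReal_nonneg

theorem volume_truncated_cone_of_neg {n : ℕ} (hn : 1 ≤ n)
    {ν : Fin (n + 1) → ℝ} (hν : minkowski ν ν = -1) (hν0 : ν 0 ≤ 0) {r : ℝ} (hr : 0 < r) :
    volume {p : Fin (n + 1) → ℝ |
        minkowski p p < 0 ∧ -r ≤ minkowski p ν ∧ minkowski p ν ≤ 0} =
      ENNReal.ofReal (unitBallVolume n * r ^ (n + 1) / (n + 1)) := by
  set e : Fin (n + 1) → ℝ := Pi.single 0 1 with he
  have hpe (p : Fin (n + 1) → ℝ) : minkowskiForm n p e = -p 0 := by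
    change minkowski p e = _
    simp [he, minkowski_eq]
  have hee : minkowskiForm n e e = -1 := by rw [hpe]; simp [he]
  have hνν : minkowskiForm n ν ν = -1 := hν
  have hw : minkowskiForm n (ν - e) (ν - e) ≠ 0 := by
    simp only [map_sub, LinearMap.sub_apply]
    rw [minkowskiForm_comm e ν, hee, hνν, hpe]
    linarith
  rw [← volume_vertical_truncated_cone hn hr,
    ← volume_preimage_of_comp_self_eq_id (minkowskiReflection_comp_self hw)]
  congr 1
  ext p
  change minkowskiForm n (minkowskiReflection (ν - e) p) (minkowskiReflection (ν - e) p) < 0 ∧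
    -r ≤ minkowskiForm n (minkowskiReflection (ν - e) p) ν ∧
    minkowskiForm n (minkowskiReflection (ν - e) p) ν ≤ 0 ↔
    minkowskiForm n p p < 0 ∧ 0 ≤ p 0 ∧ p 0 ≤ r
  rw [minkowskiForm_reflection_reflection hw, minkowskiForm_reflection_left,
    minkowskiReflection_sub_apply (hνν.trans hee.symm) hw, hpe, neg_le_neg_iff,
    neg_nonpos, and_comm (a := p 0 ≤ r)]

theorem volume_truncated_cone (n : ℕ) (hn : 1 ≤ n)
    (ν : Fin (n + 1) → ℝ) (hν : minkowski ν ν = -1) (r : ℝ) (hr : 0 < r) :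
    volume {p : Fin (n + 1) → ℝ |
        minkowski p p < 0 ∧ -r ≤ minkowski p ν ∧ minkowski p ν ≤ 0} =
      ENNReal.ofReal (unitBallVolume n * r ^ (n + 1) / (n + 1)) := by
  rcases le_total (ν 0) 0 with h | h
  · exact volume_truncated_cone_of_neg hn hν h hr
  · have hneg : minkowski (-ν) (-ν) = -1 := by simpa [minkowski_eq] using hν
    rw [← volume_truncated_cone_of_neg hn hneg (by simpa using h) hr, ← Measure.measure_neg]
    congr 1
    ext p
    simp [minkowski_eq]
end

section
/- Let n ≥ 1 and τ ≥ 1, and let S be a nonempty set of past-directed unit timelike vectors ν ∈ ℝ^{n+1} (η(ν,ν) = −1, ν₀ < 0) satisfying −ν₀ ≤ τ. Then the Lebesgue measure of the intersection ∩_{ν ∈ S} {p ∈ ℝ^{n+1} : η(p,p) < 0 and −1 ≤ η(p,ν) ≤ 0} is at least ω_n / ((n+1) · τ · (τ + √(τ²−1))ⁿ). -/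
open MeasureTheory

theorem minkowski_eq_inner {n : ℕ} (p q : Fin (n + 1) → ℝ) :
    minkowski p q = -(p 0 * q 0) +
      inner ℝ (WithLp.toLp 2 fun i : Fin n => p i.succ)
        (WithLp.toLp 2 fun i : Fin n => q i.succ) := by
  simp [minkowski, Fin.sum_univ_succ, PiLp.inner_apply, mul_comm]

/-- The splitting of `ℝ^{n+1}` into space and time coordinates preserves volume. -/
theorem measurePreserving_space_time (n : ℕ) :
    MeasurePreserving (fun p : Fin (n + 1) → ℝ =>
      ((WithLp.toLp 2 fun i : Fin n => p i.succ : EuclideanSpace ℝ (Fin n)), p 0)) := by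
  have h₁ := volume_preserving_piFinSuccAbove (fun _ : Fin (n + 1) => ℝ) 0
  have h₂ : MeasurePreserving (Prod.swap : ℝ × (Fin n → ℝ) → (Fin n → ℝ) × ℝ) :=
    Measure.measurePreserving_swap
  have h₃ : MeasurePreserving
      (Prod.map (WithLp.toLp 2 : (Fin n → ℝ) → EuclideanSpace ℝ (Fin n)) (id : ℝ → ℝ)) :=
    (PiLp.volume_preserving_toLp (Fin n)).prod (MeasurePreserving.id volume)
  exact h₃.comp (h₂.comp h₁)

theorem integral_one_sub_norm_div {n : ℕ} (hn : 1 ≤ n) {R : ℝ} (hR : 0 < R) :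
    ∫ x in Metric.ball (0 : EuclideanSpace ℝ (Fin n)) R, (1 - ‖x‖ / R) =
      unitBallVolume n * R ^ n / (n + 1) := by
  obtain ⟨m, rfl⟩ : ∃ m, n = m + 1 := ⟨n - 1, by omega⟩
  have hind : ∀ x : EuclideanSpace ℝ (Fin (m + 1)),
      (Metric.ball (0 : EuclideanSpace ℝ (Fin (m + 1))) R).indicator (fun x => 1 - ‖x‖ / R) x =
        (Set.Iio R).indicator (fun r => 1 - r / R) ‖x‖ := by
    intro x
    by_cases h : ‖x‖ < R
    · rw [Set.indicator_of_mem (mem_ball_zero_iff.2 h), Set.indicator_of_mem (Set.mem_Iio.2 h)]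
    · rw [Set.indicator_of_notMem (mt mem_ball_zero_iff.1 h),
        Set.indicator_of_notMem (mt Set.mem_Iio.1 h)]
  have hint : ∫ y in Set.Ioi (0 : ℝ), y ^ m * (Set.Iio R).indicator (fun r => 1 - r / R) y =
      R ^ (m + 1) / ((m + 1) * (m + 2)) := by
    have h : ∀ y : ℝ, y ^ m * (Set.Iio R).indicator (fun r => 1 - r / R) y =
        (Set.Iio R).indicator (fun r => r ^ m - r ^ (m + 1) / R) y := by
      intro y
      simp only [Set.indicator_apply]
      split_ifs <;> ring
    simp_rw [h]
    rw [setIntegral_indicator measurableSet_Iio, Set.Ioi_inter_Iio, ← integral_Ioc_eq_integral_Ioo,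
      ← intervalIntegral.integral_of_le hR.le, intervalIntegral.integral_sub
        (Continuous.intervalIntegrable (by fun_prop) _ _)
        (Continuous.intervalIntegrable (by fun_prop) _ _),
      intervalIntegral.integral_div, integral_pow, integral_pow]
    push_cast
    field_simp
    ring
  rw [← integral_indicator measurableSet_ball]
  simp_rw [hind]
  rw [integral_fun_norm_addHaar volume ((Set.Iio R).indicator fun r => 1 - r / R)]
  simp only [finrank_euclideanSpace, Fintype.card_fin, Nat.add_sub_cancel, smul_eq_mul,
    nsmul_eq_mul, hint, unitBallVolume, Measure.real]
  push_cast
  field_simp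
  ring

theorem mem_cone_of_space_time {n : ℕ} {τ : ℝ} (hτ : 1 ≤ τ) {p ν : Fin (n + 1) → ℝ}
    (hunit : minkowski ν ν = -1) (hpast : ν 0 < 0) (hslope : -ν 0 ≤ τ)
    (hlow : -((1 - Real.sqrt (τ ^ 2 - 1) * ‖WithLp.toLp 2 fun i : Fin n => p i.succ‖) / τ) < p 0)
    (hup : p 0 < -‖WithLp.toLp 2 fun i : Fin n => p i.succ‖) :
    minkowski p p < 0 ∧ -1 ≤ minkowski p ν ∧ minkowski p ν ≤ 0 := by
  rw [minkowski_eq_inner] at hunit ⊢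
  rw [minkowski_eq_inner]
  set x := WithLp.toLp 2 fun i : Fin n => p i.succ
  set y := WithLp.toLp 2 fun i : Fin n => ν i.succ
  rw [real_inner_self_eq_norm_sq] at hunit ⊢
  have hτ₀ : 0 < τ := by linarith
  have hx := norm_nonneg x
  have hy := norm_nonneg y
  have hxy := abs_le.1 (abs_real_inner_le_norm x y)
  have hys : ‖y‖ ≤ Real.sqrt (τ ^ 2 - 1) := by
    apply Real.le_sqrt_of_sq_le
    nlinarith
  have hyν : ‖y‖ ≤ -ν 0 := by nlinarith
  have hlow' : -p 0 * τ < 1 - Real.sqrt (τ ^ 2 - 1) * ‖x‖ := by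
    rw [← lt_div_iff₀ hτ₀]
    linarith
  have hxys := mul_le_mul_of_nonneg_left hys hx
  have hpν : -p 0 * -ν 0 ≤ -p 0 * τ := mul_le_mul_of_nonneg_left hslope (by linarith)
  have hpν' : ‖x‖ * ‖y‖ ≤ -p 0 * -ν 0 := mul_le_mul (by linarith) hyν hy (by linarith)
  refine ⟨by nlinarith, by linarith, by linarith⟩

theorem volume_inter_cones_lower_bound (n : ℕ) (hn : 1 ≤ n) (τ : ℝ) (hτ : 1 ≤ τ)
    (S : Set (Fin (n + 1) → ℝ)) (hS : S.Nonempty)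
    (hunit : ∀ ν ∈ S, minkowski ν ν = -1)
    (hpast : ∀ ν ∈ S, ν 0 < 0)
    (hslope : ∀ ν ∈ S, -ν 0 ≤ τ) :
    ENNReal.ofReal (unitBallVolume n /
        ((n + 1) * τ * (τ + Real.sqrt (τ ^ 2 - 1)) ^ n)) ≤
      volume (⋂ ν ∈ S, {p : Fin (n + 1) → ℝ |
        minkowski p p < 0 ∧ -1 ≤ minkowski p ν ∧ minkowski p ν ≤ 0}) := by
  set s := Real.sqrt (τ ^ 2 - 1) with hs
  have hτ₀ : 0 < τ := by linarith
  have hs₀ : 0 ≤ s := Real.sqrt_nonneg _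
  have hτs : 0 < τ + s := by linarith
  set R := (τ + s)⁻¹ with hR
  have hR₀ : 0 < R := inv_pos.2 hτs
  let lower : EuclideanSpace ℝ (Fin n) → ℝ := fun x => -((1 - s * ‖x‖) / τ)
  let upper : EuclideanSpace ℝ (Fin n) → ℝ := fun x => -‖x‖
  have hlower : Continuous lower := by fun_prop
  have hupper : Continuous upper := by fun_prop
  have hdiff : ∀ x, (upper - lower) x = τ⁻¹ * (1 - ‖x‖ / R) := by
    intro x
    simp only [Pi.sub_apply, upper, lower, hR]
    field_simp
    ring
  have hle : ∀ x ∈ Metric.ball (0 : EuclideanSpace ℝ (Fin n)) R, lower x ≤ upper x := by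
    intro x hx
    have h : ‖x‖ / R ≤ 1 := (div_le_one hR₀).2 (mem_ball_zero_iff.1 hx).le
    have h' : 0 ≤ τ⁻¹ * (1 - ‖x‖ / R) := mul_nonneg (inv_pos.2 hτ₀).le (by linarith)
    rw [← hdiff] at h'
    exact sub_nonneg.1 h'
  have hintegrable : ∀ f : EuclideanSpace ℝ (Fin n) → ℝ, Continuous f →
      IntegrableOn f (Metric.ball 0 R) := fun f hf =>
    (hf.continuousOn.integrableOn_compact (isCompact_closedBall 0 R)).mono_set
      Metric.ball_subset_closedBall
  have hvol := volume_regionBetween_eq_integral (μ := volume) (hintegrable lower hlower)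
    (hintegrable upper hupper) measurableSet_ball hle
  simp_rw [hdiff] at hvol
  rw [integral_const_mul, integral_one_sub_norm_div hn hR₀] at hvol
  have hconst : unitBallVolume n / ((n + 1) * τ * (τ + s) ^ n) =
      τ⁻¹ * (unitBallVolume n * R ^ n / (n + 1)) := by
    rw [hR, inv_pow]
    field_simp
  rw [hconst, ← hvol, ← Measure.volume_eq_prod, ← (measurePreserving_space_time n).measure_preimage
    (measurableSet_regionBetween hlower.measurable hupper.measurable
      measurableSet_ball).nullMeasurableSet]
  refine measure_mono fun p hp => Set.mem_iInter₂.2 fun ν hν => ?_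
  exact mem_cone_of_space_time hτ (hunit ν hν) (hpast ν hν) (hslope ν hν) hp.2.1 hp.2.2
end

section
/- Let n ≥ 1 and τ ≥ 1, and let S be a nonempty set of past-directed unit timelike vectors ν ∈ ℝ^{n+1} (η(ν,ν) = −1, ν₀ < 0) satisfying −ν₀ ≤ τ. Then the Lebesgue measure of the intersection ∩_{ν ∈ S} {p ∈ ℝ^{n+1} : η(p,p) < 0 and −1/2 ≤ η(p,ν) ≤ 1/2} is at least 2^{−n} ω_n / ((n+1) · τ · (τ + √(τ²−1))ⁿ). -/
open MeasureTheory

/-- A lower bound for the volume of a cone with base a ball of radius `R` and height `1`,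
written as the integral of its height function. -/
lemma ofReal_le_lintegral_one_sub_norm_div {E : Type*} [NormedAddCommGroup E] [NormedSpace ℝ E]
    [FiniteDimensional ℝ E] [MeasurableSpace E] [BorelSpace E] (μ : Measure E)
    [μ.IsAddHaarMeasure] {R : ℝ} (hR : 0 < R) :
    ENNReal.ofReal (R ^ Module.finrank ℝ E * μ.real (Metric.ball 0 1) /
        (Module.finrank ℝ E + 1)) ≤ ∫⁻ x, ENNReal.ofReal (1 - ‖x‖ / R) ∂μ := by
  set d := Module.finrank ℝ E
  set w := μ.real (Metric.ball (0 : E) 1)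
  have hmax : ∀ x : E, ENNReal.ofReal (1 - ‖x‖ / R) = ENNReal.ofReal (max (1 - ‖x‖ / R) 0) :=
    fun x ↦ by rcases le_total (1 - ‖x‖ / R) 0 with h | h <;> simp [h, ENNReal.ofReal_of_nonpos]
  simp_rw [hmax]
  rw [lintegral_eq_lintegral_meas_lt (f := fun x : E ↦ max (1 - ‖x‖ / R) 0) μ (Filter.Eventually.of_forall fun x ↦ le_max_right _ _)
    (by fun_prop)]
  have hlevel : ∀ t ∈ Set.Ioo (0 : ℝ) 1,
      ENNReal.ofReal ((1 - t) ^ d * (R ^ d * w)) ≤ μ {x : E | t < max (1 - ‖x‖ / R) 0} := by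
    rintro t ⟨h0, h1⟩
    have hset : {x : E | t < max (1 - ‖x‖ / R) 0} = Metric.ball 0 (R * (1 - t)) := by
      ext x
      rw [Set.mem_ofPred_eq, mem_ball_zero_iff, lt_max_iff, or_iff_left h0.not_gt, lt_sub_comm,
        div_lt_iff₀' hR]
    rw [hset, Measure.addHaar_ball_of_pos μ 0 (mul_pos hR (sub_pos.2 h1)), mul_pow,
      ← ENNReal.ofReal_toReal (measure_ball_lt_top (μ := μ) (x := (0 : E)) (r := 1)).ne,
      ← ENNReal.ofReal_mul (by have := sub_pos.2 h1; positivity)]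
    refine ENNReal.ofReal_le_ofReal (le_of_eq ?_)
    change _ = R ^ d * (1 - t) ^ d * w
    ring
  have hint : ∫ t in Set.Ioo (0 : ℝ) 1, (1 - t) ^ d * (R ^ d * w) = R ^ d * w / (d + 1) := by
    rw [← integral_Ioc_eq_integral_Ioo, ← intervalIntegral.integral_of_le zero_le_one,
      intervalIntegral.integral_mul_const,
      intervalIntegral.integral_comp_sub_left (fun t : ℝ ↦ t ^ d) 1]
    simp
    ring
  rw [← hint, ofReal_integral_eq_lintegral_ofReal]
  · calc _ ≤ ∫⁻ t in Set.Ioo (0 : ℝ) 1, μ {x : E | t < max (1 - ‖x‖ / R) 0} :=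
          setLIntegral_mono' measurableSet_Ioo hlevel
      _ ≤ _ := lintegral_mono_set Set.Ioo_subset_Ioi_self
  · exact (Continuous.integrableOn_Icc (by fun_prop)).mono_set Set.Ioo_subset_Icc_self
  · refine (ae_restrict_iff' measurableSet_Ioo).2 (Filter.Eventually.of_forall fun t ht ↦ ?_)
    have := sub_pos.2 ht.2
    positivity

/-- The two intervals cut out of a vertical line by the double cone
`{‖x‖ < |t|, |t| τ + ‖x‖ σ ≤ 1 / 2}`. -/
lemma ofReal_le_volume_double_cone_slice {r τ σ : ℝ} (hr : 0 ≤ r) (hτ : 0 < τ) :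
    ENNReal.ofReal (2 * ((1 / 2 - r * σ) / τ - r)) ≤
      volume {t : ℝ | r < |t| ∧ |t| * τ + r * σ ≤ 1 / 2} := by
  set b := (1 / 2 - r * σ) / τ with hb
  have hmem : ∀ s ≤ b, s * τ + r * σ ≤ 1 / 2 := fun s hs ↦ by
    have := (le_div_iff₀ hτ).1 hs
    linarith
  have hdisj : Disjoint (Set.Ioc r b) (Set.Ico (-b) (-r)) := by
    rw [Set.disjoint_left]
    rintro t ⟨h1, -⟩ ⟨-, h2⟩
    linarith
  calc _ = volume (Set.Ioc r b ∪ Set.Ico (-b) (-r)) := by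
        rw [measure_union hdisj measurableSet_Ico, Real.volume_Ioc, Real.volume_Ico,
          ENNReal.ofReal_mul zero_le_two, ENNReal.ofReal_ofNat, two_mul]
        ring_nf
    _ ≤ _ := by
        refine measure_mono ?_
        rintro t (⟨h1, h2⟩ | ⟨h1, h2⟩)
        · rw [Set.mem_ofPred_eq, abs_of_pos (hr.trans_lt h1)]
          exact ⟨h1, hmem t h2⟩
        · rw [Set.mem_ofPred_eq, abs_of_neg (by linarith)]
          exact ⟨by linarith, hmem (-t) (by linarith)⟩

lemma measurableSet_double_cone {E : Type*} [NormedAddCommGroup E] [MeasurableSpace E]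
    [OpensMeasurableSpace E] (τ σ : ℝ) :
    MeasurableSet {q : ℝ × E | ‖q.2‖ < |q.1| ∧ |q.1| * τ + ‖q.2‖ * σ ≤ 1 / 2} := by
  rw [Set.ofPred_and]
  exact (measurableSet_lt (by fun_prop) (by fun_prop)).inter
    (measurableSet_le (by fun_prop) (by fun_prop))

/-- A lower bound for the volume of a double cone in `ℝ × E`. -/
lemma ofReal_le_volume_double_cone {E : Type*} [NormedAddCommGroup E] [NormedSpace ℝ E]
    [FiniteDimensional ℝ E] [MeasurableSpace E] [BorelSpace E] (μ : Measure E)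
    [μ.IsAddHaarMeasure] {τ σ : ℝ} (hτ : 0 < τ) (hσ : 0 ≤ σ) :
    ENNReal.ofReal ((2 * (τ + σ))⁻¹ ^ Module.finrank ℝ E * μ.real (Metric.ball 0 1) /
        (Module.finrank ℝ E + 1) / τ) ≤
      (volume.prod μ) {q : ℝ × E | ‖q.2‖ < |q.1| ∧ |q.1| * τ + ‖q.2‖ * σ ≤ 1 / 2} := by
  have hR : 0 < (2 * (τ + σ))⁻¹ := by positivity
  rw [Measure.prod_apply_symm (measurableSet_double_cone τ σ), div_eq_inv_mul _ τ, ENNReal.ofReal_mul (by positivity)]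
  calc _ ≤ ENNReal.ofReal τ⁻¹ * ∫⁻ x, ENNReal.ofReal (1 - ‖x‖ / (2 * (τ + σ))⁻¹) ∂μ := by
        gcongr
        exact ofReal_le_lintegral_one_sub_norm_div μ hR
    _ = ∫⁻ x, ENNReal.ofReal (2 * ((1 / 2 - ‖x‖ * σ) / τ - ‖x‖)) ∂μ := by
        rw [← lintegral_const_mul _ (by fun_prop)]
        refine lintegral_congr fun x ↦ ?_
        rw [← ENNReal.ofReal_mul (by positivity)]
        congr 1
        field_simp
        ring
    _ ≤ _ := lintegral_mono fun x ↦ ofReal_le_volume_double_cone_slice (norm_nonneg x) hτ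

/-- The spatial part of a vector of `ℝ^{n,1}`. -/
def spatialPart {n : ℕ} (p : Fin (n + 1) → ℝ) : EuclideanSpace ℝ (Fin n) :=
  WithLp.toLp 2 fun i ↦ p i.succ

lemma minkowski_eq_inner_spatialPart {n : ℕ} (p q : Fin (n + 1) → ℝ) :
    minkowski p q = -(p 0 * q 0) + inner ℝ (spatialPart p) (spatialPart q) := by
  simp [minkowski, spatialPart, Fin.sum_univ_succ, PiLp.inner_apply, mul_comm]

lemma minkowski_self {n : ℕ} (p : Fin (n + 1) → ℝ) :
    minkowski p p = -p 0 ^ 2 + ‖spatialPart p‖ ^ 2 := by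
  rw [minkowski_eq_inner_spatialPart, real_inner_self_eq_norm_sq, sq (p 0)]

lemma measurePreserving_zero_spatialPart (n : ℕ) :
    MeasurePreserving (fun p : Fin (n + 1) → ℝ ↦ (p 0, spatialPart p)) volume
      (volume.prod volume) :=
  ((MeasurePreserving.id volume).prod (PiLp.volume_preserving_toLp (Fin n))).comp
    (volume_preserving_piFinSuccAbove (fun _ ↦ ℝ) 0)

lemma abs_minkowski_le {n : ℕ} {τ : ℝ} {p ν : Fin (n + 1) → ℝ} (hunit : minkowski ν ν = -1)
    (hpast : ν 0 < 0) (hslope : -ν 0 ≤ τ) :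
    |minkowski p ν| ≤ |p 0| * τ + ‖spatialPart p‖ * √(τ ^ 2 - 1) := by
  rw [minkowski_self] at hunit
  have hnorm : ‖spatialPart ν‖ ≤ √(τ ^ 2 - 1) := Real.le_sqrt_of_sq_le (by nlinarith)
  rw [minkowski_eq_inner_spatialPart]
  calc _ ≤ |p 0| * |ν 0| + ‖spatialPart p‖ * ‖spatialPart ν‖ := by
        refine (abs_add_le _ _).trans (add_le_add ?_ (abs_real_inner_le_norm _ _))
        rw [abs_neg, abs_mul]
    _ ≤ _ := by
        gcongr
        rwa [abs_of_neg hpast]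

theorem volume_inter_two_sided_cones_lower_bound (n : ℕ) (hn : 1 ≤ n) (τ : ℝ) (hτ : 1 ≤ τ)
    (S : Set (Fin (n + 1) → ℝ)) (hS : S.Nonempty)
    (hunit : ∀ ν ∈ S, minkowski ν ν = -1)
    (hpast : ∀ ν ∈ S, ν 0 < 0)
    (hslope : ∀ ν ∈ S, -ν 0 ≤ τ) :
    ENNReal.ofReal ((2 : ℝ) ^ (-(n : ℤ)) * unitBallVolume n /
        ((n + 1) * τ * (τ + Real.sqrt (τ ^ 2 - 1)) ^ n)) ≤
      volume (⋂ ν ∈ S, {p : Fin (n + 1) → ℝ |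
        minkowski p p < 0 ∧ -(1/2) ≤ minkowski p ν ∧ minkowski p ν ≤ 1/2}) := by
  have hτ0 : 0 < τ := by linarith
  have hσ : 0 ≤ √(τ ^ 2 - 1) := Real.sqrt_nonneg _
  have hcone := ofReal_le_volume_double_cone
    (volume : Measure (EuclideanSpace ℝ (Fin n))) hτ0 hσ
  rw [finrank_euclideanSpace_fin, ← (measurePreserving_zero_spatialPart n).measure_preimage
    (measurableSet_double_cone _ _).nullMeasurableSet] at hcone
  calc _ = _ := by
        congr 1
        rw [unitBallVolume, ← measureReal_def, zpow_neg, zpow_natCast, inv_pow, mul_pow]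
        field_simp
    _ ≤ _ := hcone
    _ ≤ _ := by
        refine measure_mono fun p hp ↦ Set.mem_iInter₂.2 fun ν hν ↦ ?_
        obtain ⟨htime, hsum⟩ := hp
        refine ⟨?_, abs_le.1 ((abs_minkowski_le (hunit ν hν) (hpast ν hν)
          (hslope ν hν)).trans hsum)⟩
        rw [minkowski_self]
        have := sq_lt_sq.2 ((abs_of_nonneg (norm_nonneg (spatialPart p))).trans_lt htime)
        linarith
end
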